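/- arXiv:0809.0402 — 5 statements merged into one kernel-verified Lean document; each statement's English description precedes it below -/
import Mathlib

section
/- Let M = K⟦X⟧ × X^r K⟦X⟧ be the K⟦X⟧-submodule of K((X))² consisting of pairs (α, β) with α a formal power series and β a formal power series divisible by X^r. Then Ψ(M) ⊆ M and Ψ restricted to M is surjective onto M; that is, Ψ(M) = M. (This is the computational content of the identification of Colmez's lattice D♯(ρ(r,χ)) with K⟦X⟧·e ⊕ X^r K⟦X⟧·f.) -/
/-- The operator `Ψ(α, β) = (λ⁻¹ ψ(β), −λ⁻¹ ψ(X^{(r+1)(p-1)} α))` on `K((X))²`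
(the `ψ`-operator of the `(φ,Γ)`-module `D(ρ(r,χ))` in the basis `e, f`). -/
noncomputable def PsiOp (p : ℕ) {K : Type*} [Field K] (r : ℕ) (lam : Kˣ)
    (ψ : LaurentSeries K →ₗ[K] LaurentSeries K) :
    LaurentSeries K × LaurentSeries K → LaurentSeries K × LaurentSeries K :=
  fun v =>
    (((lam⁻¹ : Kˣ) : K) • ψ v.2,
      -(((lam⁻¹ : Kˣ) : K) •
        ψ (HahnSeries.single (((r + 1) * (p - 1) : ℕ) : ℤ) (1 : K) * v.1)))

/-- The lattice `M = K⟦X⟧ × X^r K⟦X⟧` inside `K((X))²`: pairs `(α, β)` with `α` a power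
series and `β` a power series divisible by `X^r`. -/
def latticeM (K : Type*) [Field K] (r : ℕ) : Set (LaurentSeries K × LaurentSeries K) :=
  {v | (∀ n : ℤ, n < 0 → v.1.coeff n = 0) ∧ (∀ n : ℤ, n < (r : ℤ) → v.2.coeff n = 0)}

/-- Explicit preimages under `ψ`, supported in degrees congruent to `p - 1` mod `p`. -/
theorem exists_preimage (p : ℕ) (hp : p.Prime) (K : Type*) [Field K]
    (ψ : LaurentSeries K →ₗ[K] LaurentSeries K)
    (hψ : ∀ (f : LaurentSeries K) (n : ℤ),
      (ψ f).coeff n = ∑ t ∈ Finset.range p, (-1 : K) ^ t * f.coeff ((p : ℤ) * n + t))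
    (a : LaurentSeries K) (m : ℤ) (ha : ∀ n < m, a.coeff n = 0) :
    ∃ f : LaurentSeries K, ψ f = a ∧ ∀ k : ℤ, k < p * m + p - 1 → f.coeff k = 0 := by
  have hp0 : (0 : ℤ) < p := by exact_mod_cast hp.pos
  let g : ℤ → K := fun k =>
    if (p : ℤ) ∣ k + 1 then (-1 : K) ^ (p - 1) * a.coeff ((k + 1) / p - 1) else 0
  have hg : ∀ k : ℤ, k < p * m + p - 1 → g k = 0 := by
    intro k hk
    simp only [g]
    split_ifs with h
    · obtain ⟨c, hc⟩ := h
      rw [hc, Int.mul_ediv_cancel_left _ hp0.ne', ha, mul_zero]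
      have : (p : ℤ) * c < p * (m + 1) := by linarith
      have := lt_of_mul_lt_mul_left this hp0.le
      omega
    · rfl
  have hb : BddBelow (Function.support g) := by
    refine ⟨p * m + p - 1, fun k hk => ?_⟩
    by_contra h
    exact hk (hg k (not_le.mp h))
  refine ⟨HahnSeries.ofSuppBddBelow g hb, ?_, hg⟩
  ext n
  rw [hψ, Finset.sum_eq_single (p - 1)]
  · have h1 : (p : ℤ) * n + ((p - 1 : ℕ) : ℤ) + 1 = p * (n + 1) := by
      rw [Nat.cast_sub hp.one_le]; push_cast; ring
    change _ * g _ = _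
    simp only [g]
    rw [h1, if_pos (dvd_mul_right _ _), Int.mul_ediv_cancel_left _ hp0.ne', ← mul_assoc,
      ← mul_pow]
    simp
  · intro t ht hne
    change _ * g _ = _
    simp only [g]
    rw [if_neg, mul_zero]
    rw [add_assoc, Int.dvd_add_right (dvd_mul_right _ _)]
    intro h
    have ht' := Finset.mem_range.mp ht
    have := Int.le_of_dvd (by positivity) h
    omega
  · intro h
    exact absurd (Finset.mem_range.mpr (Nat.sub_lt hp.pos one_pos)) h

/-- `Ψ(M) = M`: the lattice `M = K⟦X⟧ × X^r K⟦X⟧` is stable under `Ψ` and `Ψ` is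
surjective from `M` onto `M`. Here `ψ` is the standard left inverse of Frobenius on
`K((X))`, given on coefficients by `(ψ f)_n = ∑_{t=0}^{p-1} (-1)^t f_{pn+t}`. -/
theorem stmt_0 (p : ℕ) (hp : p.Prime) (K : Type*) [Field K] [CharP K p]
    (r : ℕ) (hr : r ≤ p - 1) (lam : Kˣ)
    (ψ : LaurentSeries K →ₗ[K] LaurentSeries K)
    (hψ : ∀ (f : LaurentSeries K) (n : ℤ),
      (ψ f).coeff n = ∑ t ∈ Finset.range p, (-1 : K) ^ t * f.coeff ((p : ℤ) * n + t)) :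
    PsiOp p r lam ψ '' latticeM K r = latticeM K r := by
  have hp0 : (0 : ℤ) < p := by exact_mod_cast hp.pos
  have hr' : (r : ℤ) + 1 ≤ p := by have := hp.pos; omega
  have hN : (((r + 1) * (p - 1) : ℕ) : ℤ) = (r + 1) * (p - 1) := by
    rw [Nat.cast_mul, Nat.cast_sub hp.one_le]; push_cast; ring
  have hc : ∀ (N k : ℤ) (f : LaurentSeries K),
      (HahnSeries.single N (1 : K) * f).coeff k = f.coeff (k - N) := by
    intro N k f
    have := HahnSeries.coeff_single_mul_add (r := (1 : K)) (x := f) (a := k - N) (b := N)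
    simpa using this
  -- vanishing of low coefficients of `ψ f`
  have hv : ∀ (f : LaurentSeries K) (m : ℤ), (∀ k < p * m, f.coeff k = 0) →
      ∀ n < m, (ψ f).coeff n = 0 := by
    intro f m hf n hn
    rw [hψ]
    refine Finset.sum_eq_zero fun t ht => ?_
    have ht' : (t : ℤ) < p := by exact_mod_cast Finset.mem_range.mp ht
    rw [hf, mul_zero]
    nlinarith
  have hl : (lam : K) ≠ 0 := lam.ne_zero
  apply Set.Subset.antisymm
  · rintro _ ⟨⟨α, β⟩, ⟨h1, h2⟩, rfl⟩
    refine ⟨fun n hn => ?_, fun n hn => ?_⟩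
    · simp only [PsiOp, HahnSeries.coeff_smul]
      rw [hv β 0 (fun k hk => h2 k (by simp at hk; omega)) n hn, smul_zero]
    · simp only [PsiOp, HahnSeries.coeff_smul, HahnSeries.coeff_neg]
      rw [hv _ r (fun k hk => ?_) n hn, smul_zero, neg_zero]
      rw [hc, hN]
      apply h1
      nlinarith
  · rintro ⟨a, b⟩ ⟨h1, h2⟩
    obtain ⟨f, hf, hf0⟩ := exists_preimage p hp K ψ hψ a 0 h1
    obtain ⟨g, hg, hg0⟩ := exists_preimage p hp K ψ hψ b r h2
    refine ⟨(HahnSeries.single (-(((r + 1) * (p - 1) : ℕ) : ℤ)) (1 : K) * (-((lam : K) • g)),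
      (lam : K) • f), ⟨fun n hn => ?_, fun n hn => ?_⟩, ?_⟩
    · simp only [hc, HahnSeries.coeff_smul, HahnSeries.coeff_neg]
      rw [hg0, smul_zero, neg_zero]
      rw [hN]
      nlinarith
    · simp only [HahnSeries.coeff_smul]
      rw [hf0 n (by simp; omega), smul_zero]
    · simp only [PsiOp]
      rw [← mul_assoc, HahnSeries.single_mul_single, add_neg_cancel, one_mul,
        HahnSeries.single_zero_one, one_mul, map_neg, map_smul, map_smul, hf, hg, smul_neg,
        neg_neg, smul_smul, smul_smul, Units.inv_mul, one_smul, one_smul]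
end

section
/- Suppose K is a finite field of characteristic p. If N is a finitely generated K⟦X⟧-submodule of K((X))² which generates K((X))² as a K((X))-vector space (i.e. N is a lattice), and if Ψ(N) ⊆ N with Ψ surjective from N onto N, then N = K⟦X⟧ × X^r K⟦X⟧. (Uniqueness of the ψ-stable lattice with surjective ψ in D(ρ(r,χ)), identifying it with Colmez's D♯.) -/
/-- vanishing of coefficients below `a` -/
def ZBelow {K : Type*} [Field K] (a : ℤ) (f : LaurentSeries K) : Prop :=
  ∀ n : ℤ, n < a → f.coeff n = 0

theorem zBelow_iff {K : Type*} [Field K] (a : ℤ) (f : LaurentSeries K) :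
    ZBelow a f ↔ ∃ g : PowerSeries K,
      f = HahnSeries.single a (1 : K) * (g : LaurentSeries K) := by
  constructor
  · intro h
    refine ⟨PowerSeries.mk fun n => f.coeff (a + n), ?_⟩
    ext n
    rw [HahnSeries.coeff_single_mul, one_mul, PowerSeries.coeff_coe]
    split_ifs with hn
    · exact h n (by omega)
    · rw [PowerSeries.coeff_mk]
      congr 1
      omega
  · rintro ⟨g, rfl⟩ n hn
    rw [HahnSeries.coeff_single_mul, one_mul, PowerSeries.coeff_coe, if_pos (by omega)]

theorem ps_smul_eq {K : Type*} [Field K] (g : PowerSeries K) (f : LaurentSeries K) :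
    g • f = (g : LaurentSeries K) * f := by
  rw [Algebra.smul_def]
  rfl

theorem ZBelow.smul {K : Type*} [Field K] {a : ℤ} {f : LaurentSeries K} (h : ZBelow a f)
    (g : PowerSeries K) : ZBelow a (g • f) := by
  obtain ⟨k, rfl⟩ := (zBelow_iff a f).1 h
  refine (zBelow_iff a _).2 ⟨g * k, ?_⟩
  rw [ps_smul_eq, PowerSeries.coe_mul]
  ring

theorem ZBelow.mono {K : Type*} [Field K] {a b : ℤ} {f : LaurentSeries K} (h : ZBelow a f)
    (hb : b ≤ a) : ZBelow b f := fun n hn => h n (by omega)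

theorem exists_zBelow {K : Type*} [Field K] (f : LaurentSeries K) : ∃ a, ZBelow a f :=
  ⟨f.order, fun _ hn => HahnSeries.coeff_eq_zero_of_lt_order hn⟩

/-- the lattice `X^a × X^b` -/
def XLat (K : Type*) [Field K] (a b : ℤ) :
    Submodule (PowerSeries K) (LaurentSeries K × LaurentSeries K) where
  carrier := {v | ZBelow a v.1 ∧ ZBelow b v.2}
  add_mem' := by
    rintro u v ⟨h1, h2⟩ ⟨h3, h4⟩
    refine ⟨fun n hn => ?_, fun n hn => ?_⟩
    · simp [h1 n hn, h3 n hn]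
    · simp [h2 n hn, h4 n hn]
  zero_mem' := ⟨fun n _ => by simp, fun n _ => by simp⟩
  smul_mem' := by
    rintro g v ⟨h1, h2⟩
    exact ⟨h1.smul g, h2.smul g⟩

theorem mem_Lat {K : Type*} [Field K] {a b : ℤ} {v : LaurentSeries K × LaurentSeries K} :
    v ∈ XLat K a b ↔ ZBelow a v.1 ∧ ZBelow b v.2 := Iff.rfl

theorem fg_le_Lat {K : Type*} [Field K]
    (N : Submodule (PowerSeries K) (LaurentSeries K × LaurentSeries K)) (h : N.FG) :
    ∃ a b, N ≤ XLat K a b := by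
  classical
  obtain ⟨S, rfl⟩ := h
  suffices ∃ a b, ∀ v ∈ S, v ∈ XLat K a b by
    obtain ⟨a, b, h⟩ := this
    exact ⟨a, b, Submodule.span_le.2 h⟩
  induction S using Finset.induction_on with
  | empty => exact ⟨0, 0, by simp⟩
  | insert v S _ ih =>
    obtain ⟨a, b, h⟩ := ih
    obtain ⟨c, hc⟩ := exists_zBelow v.1
    obtain ⟨d, hd⟩ := exists_zBelow v.2
    refine ⟨min a c, min b d, fun w hw => ?_⟩
    rcases Finset.mem_insert.1 hw with rfl | hw
    · exact ⟨hc.mono (min_le_right _ _), hd.mono (min_le_right _ _)⟩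
    · exact ⟨(h w hw).1.mono (min_le_left _ _), (h w hw).2.mono (min_le_left _ _)⟩

theorem clear_denoms {K : Type*} [Field K]
    (N : Submodule (PowerSeries K) (LaurentSeries K × LaurentSeries K))
    (v : LaurentSeries K × LaurentSeries K)
    (hv : v ∈ Submodule.span (LaurentSeries K) (N : Set (LaurentSeries K × LaurentSeries K))) :
    ∃ k : ℤ, ∀ f : LaurentSeries K, ZBelow k f → f • v ∈ N := by
  induction hv using Submodule.span_induction with
  | mem v hv =>
    refine ⟨0, fun f hf => ?_⟩
    obtain ⟨g, rfl⟩ := (zBelow_iff 0 f).1 hf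
    have := N.smul_mem g hv
    convert this using 1
    ext1 <;> simp [ps_smul_eq]
  | zero => exact ⟨0, fun f _ => by simp⟩
  | add u v _ _ h1 h2 =>
    obtain ⟨k, hk⟩ := h1
    obtain ⟨l, hl⟩ := h2
    refine ⟨max k l, fun f hf => ?_⟩
    rw [smul_add]
    exact N.add_mem (hk f (hf.mono (le_max_left _ _))) (hl f (hf.mono (le_max_right _ _)))
  | smul c v _ h =>
    obtain ⟨k, hk⟩ := h
    obtain ⟨a, ha⟩ := exists_zBelow c
    refine ⟨k - a, fun f hf => ?_⟩
    rw [smul_smul]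
    apply hk
    obtain ⟨g, rfl⟩ := (zBelow_iff _ f).1 hf
    obtain ⟨g', rfl⟩ := (zBelow_iff _ c).1 ha
    refine (zBelow_iff _ _).2 ⟨g * g', ?_⟩
    rw [PowerSeries.coe_mul, mul_mul_mul_comm, HahnSeries.single_mul_single]
    simp

theorem Lat_le {K : Type*} [Field K]
    (N : Submodule (PowerSeries K) (LaurentSeries K × LaurentSeries K))
    (hspan : Submodule.span (LaurentSeries K)
      (N : Set (LaurentSeries K × LaurentSeries K)) = ⊤) :
    ∃ a b, XLat K a b ≤ N := by
  obtain ⟨a, ha⟩ := clear_denoms N (1, 0) (by rw [hspan]; trivial)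
  obtain ⟨b, hb⟩ := clear_denoms N (0, 1) (by rw [hspan]; trivial)
  refine ⟨a, b, fun v hv => ?_⟩
  have := N.add_mem (ha _ hv.1) (hb _ hv.2)
  convert this using 1
  ext1 <;> simp

theorem dyn_step (p r : ℕ) (hp : 2 ≤ p) (hr : r ≤ p - 1) (a : ℤ) :
    (a ≠ 0 → ((a + ((r + 1) * (p - 1) : ℕ)) / p / p).natAbs < a.natAbs) ∧
    (((r + 1) * (p - 1) : ℕ) : ℤ) / p = r := by
  obtain ⟨q, rfl⟩ : ∃ q, p = q + 1 := ⟨p - 1, by omega⟩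
  simp only [Nat.add_sub_cancel] at hr ⊢
  push_cast
  have hq : (1 : ℤ) ≤ q := by omega
  have hr' : (r : ℤ) ≤ q := by omega
  have hr0 : (0 : ℤ) ≤ r := by omega
  generalize (q : ℤ) = Q at *
  generalize (r : ℤ) = R at *
  have hpos : 0 < Q + 1 := by omega
  constructor
  · intro ha
    rw [Int.ediv_ediv_of_nonneg hpos.le]
    have hpp : 0 < (Q + 1) * (Q + 1) := by positivity
    rcases lt_or_gt_of_ne ha with h | h
    · have h1 : a + 1 ≤ (a + (R + 1) * Q) / ((Q + 1) * (Q + 1)) := by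
        rw [Int.le_ediv_iff_mul_le hpp]
        nlinarith [mul_nonneg hr0 (by omega : 0 ≤ Q), mul_nonneg (by omega : 0 ≤ -a - 1) hpp.le]
      have h2 : (a + (R + 1) * Q) / ((Q + 1) * (Q + 1)) < 1 := by
        rw [Int.ediv_lt_iff_lt_mul hpp]
        nlinarith [mul_nonneg (by omega : 0 ≤ Q - R) (by omega : 0 ≤ Q)]
      omega
    · have h1 : 0 ≤ (a + (R + 1) * Q) / ((Q + 1) * (Q + 1)) := by
        apply Int.ediv_nonneg _ hpp.le
        have : 0 ≤ (R + 1) * Q := by positivity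
        omega
      have h2 : (a + (R + 1) * Q) / ((Q + 1) * (Q + 1)) < a := by
        rw [Int.ediv_lt_iff_lt_mul hpp]
        nlinarith [mul_nonneg (by omega : 0 ≤ Q - R) (by omega : 0 ≤ Q),
          mul_nonneg (by omega : 0 ≤ a - 1) (by nlinarith : 0 ≤ (Q + 1) * (Q + 1) - 1)]
      omega
  · apply le_antisymm
    · rw [← Int.lt_add_one_iff, Int.ediv_lt_iff_lt_mul hpos]
      nlinarith
    · rw [Int.le_ediv_iff_mul_le hpos]
      nlinarith

theorem dyn (p r : ℕ) (hp : 2 ≤ p) (hr : r ≤ p - 1) (P : ℤ → ℤ → Prop)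
    (hP : ∀ a b, P a b → P (b / p) ((a + ((r + 1) * (p - 1) : ℕ)) / p)) :
    ∀ (m : ℕ) (a b : ℤ), a.natAbs + (b / p).natAbs ≤ m → P a b → P 0 r := by
  intro m
  induction m using Nat.strong_induction_on with
  | _ m ih =>
    intro a b hm h
    have h1 := hP a b h
    have e := (dyn_step p r hp hr 0).2
    by_cases ha : a = 0
    · subst ha
      rw [zero_add, e] at h1
      by_cases hb : b / p = 0
      · rwa [hb] at h1
      · have h2 := hP _ _ h1
        have hlt := (dyn_step p r hp hr (b / p)).1 hb
        have hrp : (r : ℤ) / p = 0 := Int.ediv_eq_zero_of_lt (by omega) (by omega)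
        rw [hrp] at h2
        exact ih _ (by rw [Int.natAbs_zero, zero_add] at hm ⊢; omega) _ _ le_rfl h2
    · have hlt := (dyn_step p r hp hr a).1 ha
      exact ih _ (by omega) _ _ le_rfl h1

theorem psi_below {K : Type*} [Field K] (p : ℕ) (hp : 2 ≤ p)
    (ψ : LaurentSeries K →ₗ[K] LaurentSeries K)
    (hψ : ∀ (f : LaurentSeries K) (n : ℤ),
      (ψ f).coeff n = ∑ t ∈ Finset.range p, (-1 : K) ^ t * f.coeff ((p : ℤ) * n + t))
    (b : ℤ) (f : LaurentSeries K) (hf : ZBelow b f) : ZBelow (b / p) (ψ f) := by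
  intro n hn
  rw [hψ]
  refine Finset.sum_eq_zero fun t ht => ?_
  rw [hf, mul_zero]
  have ht' := Finset.mem_range.1 ht
  have h1 : (n + 1) * p ≤ b := (Int.le_ediv_iff_mul_le (by omega)).1 (by omega)
  have : (p : ℤ) * n + p ≤ b := by linarith
  omega

theorem psi_lift {K : Type*} [Field K] (p : ℕ) (hp : 2 ≤ p)
    (ψ : LaurentSeries K →ₗ[K] LaurentSeries K)
    (hψ : ∀ (f : LaurentSeries K) (n : ℤ),
      (ψ f).coeff n = ∑ t ∈ Finset.range p, (-1 : K) ^ t * f.coeff ((p : ℤ) * n + t))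
    (b : ℤ) (w : LaurentSeries K) (hw : ZBelow (b / p) w) :
    ∃ f, ZBelow b f ∧ ψ f = w := by
  have hp0 : (0 : ℤ) < p := by omega
  obtain ⟨t0, ht0⟩ := Int.eq_ofNat_of_zero_le (Int.emod_nonneg b hp0.ne')
  have ht0p : (t0 : ℤ) < p := by rw [← ht0]; exact Int.emod_lt_of_pos b hp0
  have hb : (p : ℤ) * (b / p) + t0 = b := by rw [← ht0]; exact Int.mul_ediv_add_emod b p
  let e : ℤ ↪o ℤ := OrderEmbedding.ofStrictMono (fun n => (p : ℤ) * n + t0) (by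
    intro x y hxy
    have := mul_lt_mul_of_pos_left hxy hp0
    simp only
    omega)
  have he : ∀ n, e n = (p : ℤ) * n + t0 := fun n => rfl
  have hF : ∀ n, (HahnSeries.embDomain e w).coeff ((p : ℤ) * n + t0) = w.coeff n := by
    intro n
    rw [← he, HahnSeries.embDomain_coeff]
  have hF' : ∀ m, (∀ n, (p : ℤ) * n + t0 ≠ m) → (HahnSeries.embDomain e w).coeff m = 0 := by
    intro m hm
    apply HahnSeries.embDomain_of_notMem_range
    rintro ⟨n, hn⟩
    exact hm n hn
  refine ⟨((-1 : K) ^ t0) • HahnSeries.embDomain e w, ?_, ?_⟩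
  · intro m hm
    rw [HahnSeries.coeff_smul]
    by_cases h : ∃ n, (p : ℤ) * n + t0 = m
    · obtain ⟨n, rfl⟩ := h
      rw [hF, hw n, smul_zero]
      by_contra hc
      have := mul_le_mul_of_nonneg_left (not_lt.1 hc) hp0.le
      omega
    · push Not at h
      rw [hF' m h, smul_zero]
  · ext n
    rw [hψ, Finset.sum_eq_single t0]
    · rw [HahnSeries.coeff_smul, hF, smul_eq_mul, ← mul_assoc, ← mul_pow]
      simp
    · intro t ht hne
      have ht' := Finset.mem_range.1 ht
      rw [HahnSeries.coeff_smul, hF', smul_zero, mul_zero]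
      intro k hk
      apply hne
      have h1 : (p : ℤ) ∣ (t : ℤ) - t0 := ⟨k - n, by linarith⟩
      have h2 := Int.eq_zero_of_abs_lt_dvd h1 (by rw [abs_lt]; omega)
      omega
    · intro h
      exact absurd (Finset.mem_range.2 (by omega)) h

theorem ZBelow.ksmul {K : Type*} [Field K] {a : ℤ} {f : LaurentSeries K} (h : ZBelow a f)
    (c : K) : ZBelow a (c • f) := fun n hn => by
  rw [HahnSeries.coeff_smul, h n hn, smul_zero]

theorem ZBelow.kneg {K : Type*} [Field K] {a : ℤ} {f : LaurentSeries K} (h : ZBelow a f) :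
    ZBelow a (-f) := fun n hn => by
  rw [HahnSeries.coeff_neg, h n hn, neg_zero]

theorem ZBelow.single_mul {K : Type*} [Field K] {a : ℤ} {f : LaurentSeries K}
    (h : ZBelow a f) (c : ℤ) :
    ZBelow (a + c) (HahnSeries.single c (1 : K) * f) := fun n hn => by
  rw [HahnSeries.coeff_single_mul, h _ (by omega), mul_zero]

theorem PsiOp_mem {K : Type*} [Field K] (p : ℕ) (hp : 2 ≤ p) (r : ℕ) (lam : Kˣ)
    (ψ : LaurentSeries K →ₗ[K] LaurentSeries K)
    (hψ : ∀ (f : LaurentSeries K) (n : ℤ),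
      (ψ f).coeff n = ∑ t ∈ Finset.range p, (-1 : K) ^ t * f.coeff ((p : ℤ) * n + t))
    (a b : ℤ) (v : LaurentSeries K × LaurentSeries K) (hv : v ∈ XLat K a b) :
    PsiOp p r lam ψ v ∈ XLat K (b / p) ((a + ((r + 1) * (p - 1) : ℕ)) / p) :=
  ⟨(psi_below p hp ψ hψ _ _ hv.2).ksmul _,
    ((psi_below p hp ψ hψ _ _ (hv.1.single_mul _)).ksmul _).kneg⟩

theorem PsiOp_lift {K : Type*} [Field K] (p : ℕ) (hp : 2 ≤ p) (r : ℕ) (lam : Kˣ)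
    (ψ : LaurentSeries K →ₗ[K] LaurentSeries K)
    (hψ : ∀ (f : LaurentSeries K) (n : ℤ),
      (ψ f).coeff n = ∑ t ∈ Finset.range p, (-1 : K) ^ t * f.coeff ((p : ℤ) * n + t))
    (a b : ℤ) (w : LaurentSeries K × LaurentSeries K)
    (hw : w ∈ XLat K (b / p) ((a + ((r + 1) * (p - 1) : ℕ)) / p)) :
    ∃ v ∈ XLat K a b, PsiOp p r lam ψ v = w := by
  obtain ⟨β, hβ, hβ'⟩ := psi_lift p hp ψ hψ _ _ (hw.1.ksmul (lam : K))
  obtain ⟨α, hα, hα'⟩ := psi_lift p hp ψ hψ _ _ ((hw.2.ksmul (lam : K)).kneg)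
  have hs : HahnSeries.single (((r + 1) * (p - 1) : ℕ) : ℤ) (1 : K) *
      (HahnSeries.single (-(((r + 1) * (p - 1) : ℕ) : ℤ)) (1 : K) * α) = α := by
    rw [← mul_assoc, HahnSeries.single_mul_single, add_neg_cancel, one_mul]
    exact one_mul α
  refine ⟨(HahnSeries.single (-(((r + 1) * (p - 1) : ℕ) : ℤ)) (1 : K) * α, β), ⟨?_, hβ⟩, ?_⟩
  · have := hα.single_mul (-(((r + 1) * (p - 1) : ℕ) : ℤ))
    rwa [add_neg_cancel_right] at this
  · unfold PsiOp
    simp only [hs, hα', hβ']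
    ext1
    · simp [smul_smul]
    · simp [smul_smul]

/-- Uniqueness of the `ψ`-stable lattice with surjective `ψ` in `D(ρ(r,χ))`: if `K` is a
finite field and `N` is a finitely generated `K⟦X⟧`-submodule of `K((X))²` generating
`K((X))²` as a `K((X))`-vector space, stable under `Ψ` with `Ψ` surjective from `N`
onto `N`, then `N = K⟦X⟧ × X^r K⟦X⟧` (Colmez's lattice `D♯`). -/
theorem stmt_1 (p : ℕ) (hp : p.Prime) (K : Type*) [Field K] [Finite K] [CharP K p]
    (r : ℕ) (hr : r ≤ p - 1) (lam : Kˣ)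
    (ψ : LaurentSeries K →ₗ[K] LaurentSeries K)
    (hψ : ∀ (f : LaurentSeries K) (n : ℤ),
      (ψ f).coeff n = ∑ t ∈ Finset.range p, (-1 : K) ^ t * f.coeff ((p : ℤ) * n + t))
    (N : Submodule (PowerSeries K) (LaurentSeries K × LaurentSeries K))
    (hfg : N.FG)
    (hspan : Submodule.span (LaurentSeries K)
      (N : Set (LaurentSeries K × LaurentSeries K)) = ⊤)
    (hstab : ∀ v ∈ N, PsiOp p r lam ψ v ∈ N)
    (hsurj : ∀ w ∈ N, ∃ v ∈ N, PsiOp p r lam ψ v = w) :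
    (N : Set (LaurentSeries K × LaurentSeries K)) =
      {v | (∀ n : ℤ, n < 0 → v.1.coeff n = 0) ∧
        (∀ n : ℤ, n < (r : ℤ) → v.2.coeff n = 0)} := by
  have hp2 : 2 ≤ p := hp.two_le
  have h1 : N ≤ XLat K 0 r := by
    obtain ⟨a, b, h⟩ := fg_le_Lat N hfg
    refine dyn p r hp2 hr (fun a b => N ≤ XLat K a b) (fun a b hab w hw => ?_) _ a b le_rfl h
    obtain ⟨v, hv, rfl⟩ := hsurj w hw
    exact PsiOp_mem p hp2 r lam ψ hψ a b v (hab hv)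
  have h2 : XLat K 0 r ≤ N := by
    obtain ⟨a, b, h⟩ := Lat_le N hspan
    refine dyn p r hp2 hr (fun a b => XLat K a b ≤ N) (fun a b hab w hw => ?_) _ a b le_rfl h
    obtain ⟨v, hv, rfl⟩ := PsiOp_lift p hp2 r lam ψ hψ a b w hw
    exact hstab v (hab hv)
  ext v
  exact ⟨fun hv => h1 hv, fun hv => h2 hv⟩
end

section
/- Let k and t be natural numbers with k + t ≤ p - 2. Then ∑_{j=0}^{p-1} j^k · binomial(j, t) ≡ 0 (mod p) (with the convention 0^0 = 1, and binomial(j,t) = 0 when t > j). -/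
theorem stmt_7_base (p : ℕ) (hp : p.Prime) (k : ℕ) (h : k ≤ p - 2) :
    ((∑ j ∈ Finset.range p, j ^ k : ℕ) : ZMod p) = 0 := by
  haveI : Fact p.Prime := ⟨hp⟩
  have h2 := hp.two_le
  have h1 := FiniteField.sum_pow_lt_card_sub_one (ZMod p) k (by rw [ZMod.card]; omega)
  rw [← h1]
  push_cast
  refine Finset.sum_bij' (fun j _ => (j : ZMod p)) (fun x _ => x.val) ?_ ?_ ?_ ?_ ?_
  · intros; simp
  · intro x _; simpa using ZMod.val_lt x
  · intro j hj; exact ZMod.val_cast_of_lt (by simpa using hj)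
  · intro x _; simp
  · intros; rfl

/-- If `k + t ≤ p - 2` then `∑_{j=0}^{p-1} j^k * C(j,t) ≡ 0 (mod p)`. -/
theorem stmt_7 (p : ℕ) (hp : p.Prime) (k t : ℕ) (h : k + t ≤ p - 2) :
    ((∑ j ∈ Finset.range p, j ^ k * j.choose t : ℕ) : ZMod p) = 0 := by
  haveI : Fact p.Prime := ⟨hp⟩
  have h2 := hp.two_le
  induction t generalizing k with
  | zero => simpa using stmt_7_base p hp k h
  | succ t ih =>
    have e1 := ih (k + 1) (by omega)
    have e2 := ih k (by omega)
    have key : (t + 1) * (∑ j ∈ Finset.range p, j ^ k * j.choose (t + 1))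
        + t * (∑ j ∈ Finset.range p, j ^ k * j.choose t)
        = ∑ j ∈ Finset.range p, j ^ (k + 1) * j.choose t := by
      rw [Finset.mul_sum, Finset.mul_sum, ← Finset.sum_add_distrib]
      refine Finset.sum_congr rfl fun j _ => ?_
      have e : j.choose (t + 1) * (t + 1) + t * j.choose t = j * j.choose t := by
        rw [Nat.choose_succ_right_eq]
        rcases le_or_gt t j with hj | hj
        · obtain ⟨d, rfl⟩ := Nat.exists_eq_add_of_le hj
          rw [Nat.add_sub_cancel_left]; ring
        · simp [Nat.choose_eq_zero_of_lt hj]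
      calc _ = j ^ k * (j.choose (t + 1) * (t + 1) + t * j.choose t) := by ring
        _ = _ := by rw [e]; ring
    have key' := congrArg (Nat.cast : ℕ → ZMod p) key
    rw [e1, Nat.cast_add, Nat.cast_mul, Nat.cast_mul, e2, mul_zero, add_zero] at key'
    refine (mul_eq_zero.mp key').resolve_left fun h0 => ?_
    rw [ZMod.natCast_eq_zero_iff] at h0
    have := Nat.le_of_dvd (by omega) h0
    omega
end

section
/- Let r be an integer with 1 ≤ r ≤ p-1 and set P = ∑_{j=0}^{p-1} j^r (1+X)^j in (ℤ/pℤ)[X] (where j^r is computed in ℤ/pℤ). Then the coefficient of X^t in P is 0 for every t < p-1-r, and the coefficient of X^{p-1-r} in P equals −((p-1-r)!)⁻¹, the negative of the inverse in ℤ/pℤ of the factorial (p-1-r)!. In other words, the first nonzero term of ∑_{j=0}^{p-1} j^r (1+X)^j is −X^{p-1-r}/(p-1-r)!. -/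
open Polynomial in
lemma aux_sum (p : ℕ) [Fact p.Prime] (Q : Polynomial (ZMod p)) (hQ : Q.natDegree ≤ p - 1) :
    ∑ j ∈ Finset.range p, Q.eval (j : ZMod p) = - Q.coeff (p - 1) := by
  have hp : p.Prime := Fact.out
  have h2 := hp.two_le
  have h0 : ∑ j ∈ Finset.range p, Q.eval (j : ZMod p) = ∑ x : ZMod p, Q.eval x := by
    refine Finset.sum_bij (fun j _ => (j : ZMod p)) (by simp) ?_ ?_ (by simp)
    · intro a ha b hb hab
      rw [ZMod.natCast_eq_natCast_iff'] at hab
      rwa [Nat.mod_eq_of_lt (Finset.mem_range.1 ha), Nat.mod_eq_of_lt (Finset.mem_range.1 hb)] at hab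
    · intro b _
      exact ⟨b.val, Finset.mem_range.2 (ZMod.val_lt b), by simp⟩
  have h1 : ∑ x : ZMod p, x ^ (p - 1) = -1 := by
    have : ∀ x : ZMod p, x ^ (p - 1) = 1 - if x = 0 then 1 else 0 := by
      intro x
      split_ifs with h
      · subst h
        rw [zero_pow (by omega)]; simp
      · rw [ZMod.pow_card_sub_one_eq_one h]; simp
    simp [this]
  rw [h0]
  simp_rw [eval_eq_sum_range' (show Q.natDegree < p - 1 + 1 by omega)]
  rw [Finset.sum_comm, Finset.sum_range_succ, ← Finset.mul_sum, h1, Finset.sum_eq_zero]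
  · simp
  · intro i hi
    rw [← Finset.mul_sum, FiniteField.sum_pow_lt_card_sub_one, mul_zero]
    simpa using hi

open Polynomial in
lemma aux_coeff (p : ℕ) [Fact p.Prime] (r t : ℕ) (h : r + t ≤ p - 1) :
    (t.factorial : ZMod p) * (∑ j ∈ Finset.range p,
      Polynomial.C ((j : ZMod p) ^ r) * (1 + Polynomial.X : Polynomial (ZMod p)) ^ j).coeff t
    = - (X ^ r * descPochhammer (ZMod p) t).coeff (p - 1) := by
  rw [← aux_sum, finset_sum_coeff, Finset.mul_sum]
  · refine Finset.sum_congr rfl fun j _ => ?_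
    rw [coeff_C_mul, coeff_one_add_X_pow, eval_mul, descPochhammer_eval_eq_descFactorial,
      Nat.descFactorial_eq_factorial_mul_choose]
    simp
    ring
  · refine natDegree_mul_le.trans ?_
    simpa [descPochhammer_natDegree] using h

/-- For `1 ≤ r ≤ p-1`, the polynomial `P = ∑_{j=0}^{p-1} j^r (1+X)^j` over `ℤ/pℤ` has
vanishing coefficients in degrees `< p-1-r`, and its coefficient in degree `p-1-r`
equals `-((p-1-r)!)⁻¹`. -/
theorem stmt_8 (p : ℕ) (hp : p.Prime) (r : ℕ) (hr1 : 1 ≤ r) (hr2 : r ≤ p - 1)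
    (P : Polynomial (ZMod p))
    (hP : P = ∑ j ∈ Finset.range p,
      Polynomial.C ((j : ZMod p) ^ r) * (1 + Polynomial.X : Polynomial (ZMod p)) ^ j) :
    (∀ t < p - 1 - r, P.coeff t = 0) ∧
      P.coeff (p - 1 - r) = -(((p - 1 - r).factorial : ZMod p))⁻¹ := by
  haveI : Fact p.Prime := ⟨hp⟩
  have h2 := hp.two_le
  have hf : ∀ t ≤ p - 1 - r, (t.factorial : ZMod p) ≠ 0 := by
    intro t ht h
    rw [ZMod.natCast_eq_zero_iff, hp.dvd_factorial] at h
    omega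
  subst hP
  constructor
  · intro t ht
    have h := aux_coeff p r t (by omega)
    rw [Polynomial.coeff_eq_zero_of_natDegree_lt (p := Polynomial.X ^ r * descPochhammer (ZMod p) t), neg_zero] at h
    · exact (mul_eq_zero.1 h).resolve_left (hf t ht.le)
    · refine Polynomial.natDegree_mul_le.trans_lt ?_
      simp only [Polynomial.natDegree_X_pow, descPochhammer_natDegree]
      omega
  · have h := aux_coeff p r (p - 1 - r) (by omega)
    have hm := (monic_descPochhammer (ZMod p) (p - 1 - r)).coeff_natDegree
    rw [descPochhammer_natDegree] at hm
    rw [Polynomial.coeff_X_pow_mul', if_pos hr2, hm] at h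
    have h3 := hf _ le_rfl
    apply mul_left_cancel₀ h3
    rw [h, mul_neg, mul_inv_cancel₀ h3]
end

section
/- Let A ⊂ ℚ_p be the set of elements of the form α_n p^{-n} + ⋯ + α_1 p^{-1} with n ≥ 0 and each α_j ∈ {0, …, p-1} (equivalently, rational numbers m/p^n with 0 ≤ m < p^n, viewed inside ℚ_p). Then every b ∈ B admits a unique factorization b = [[1, β],[0, p^δ]] · c with β ∈ A, δ ∈ ℤ, and c ∈ B ∩ KZ. That is, B is the disjoint union over β ∈ A and δ ∈ ℤ of the cosets [[1, β],[0, p^δ]]·(B ∩ KZ). -/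
open Matrix

lemma exists_repr_aux (p : ℕ) [hp : Fact p.Prime] (x : ℚ_[p]) :
    ∃ n m : ℕ, m < p ^ n ∧ ‖x - (m : ℚ_[p]) / (p : ℚ_[p]) ^ n‖ ≤ 1 := by
  have hp0 : (p : ℚ_[p]) ≠ 0 := by exact_mod_cast hp.out.ne_zero
  have hp1 : (1 : ℝ) < p := by exact_mod_cast hp.out.one_lt
  obtain ⟨n, hn⟩ := pow_unbounded_of_one_lt ‖x‖ hp1
  have hpn : (0 : ℝ) < (p : ℝ) ^ n := by positivity
  have hy : ‖x * (p : ℚ_[p]) ^ n‖ ≤ 1 := by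
    rw [norm_mul, norm_pow, Padic.norm_p, inv_pow, ← div_eq_mul_inv, div_le_one hpn]
    exact hn.le
  let y : ℤ_[p] := ⟨x * (p : ℚ_[p]) ^ n, hy⟩
  refine ⟨n, y.appr n, PadicInt.appr_lt y n, ?_⟩
  have h := PadicInt.appr_spec n y
  rw [← PadicInt.norm_le_pow_iff_mem_span_pow, PadicInt.norm_def] at h
  have h2 : ((y - (y.appr n : ℤ_[p]) : ℤ_[p]) : ℚ_[p]) = x * (p : ℚ_[p]) ^ n - (y.appr n : ℚ_[p]) := by
    push_cast
    rfl
  rw [h2] at h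
  have h3 : x - (y.appr n : ℚ_[p]) / (p : ℚ_[p]) ^ n
      = (x * (p : ℚ_[p]) ^ n - (y.appr n : ℚ_[p])) / (p : ℚ_[p]) ^ n := by
    field_simp
  rw [h3, norm_div, norm_pow, Padic.norm_p, inv_pow]
  rw [div_le_one (by positivity)]
  simpa [_root_.zpow_neg] using h

lemma unique_repr_aux (p : ℕ) [hp : Fact p.Prime] (n m n' m' : ℕ) (h : m < p ^ n)
    (h' : m' < p ^ n')
    (hd : ‖(m : ℚ_[p]) / (p : ℚ_[p]) ^ n - (m' : ℚ_[p]) / (p : ℚ_[p]) ^ n'‖ ≤ 1) :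
    (m : ℚ_[p]) / (p : ℚ_[p]) ^ n = (m' : ℚ_[p]) / (p : ℚ_[p]) ^ n' := by
  have hp0 : (p : ℚ_[p]) ≠ 0 := by exact_mod_cast hp.out.ne_zero
  have hpp : 0 < p := hp.out.pos
  have e : (m : ℚ_[p]) / (p : ℚ_[p]) ^ n - (m' : ℚ_[p]) / (p : ℚ_[p]) ^ n'
      = (((m * p ^ n' - m' * p ^ n : ℤ)) : ℚ_[p]) / (p : ℚ_[p]) ^ (n + n') := by
    push_cast
    rw [pow_add]
    field_simp
  have hz : (m * p ^ n' - m' * p ^ n : ℤ) = 0 := by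
    rw [e, norm_div, norm_pow, Padic.norm_p, inv_pow, div_le_one (by positivity)] at hd
    have hdvd : ((p ^ (n + n') : ℕ) : ℤ) ∣ (m * p ^ n' - m' * p ^ n : ℤ) := by
      have := (Padic.norm_int_le_pow_iff_dvd (p := p) (m * p ^ n' - m' * p ^ n : ℤ) (n + n')).1
        (by rw [_root_.zpow_neg, zpow_natCast]; exact hd)
      exact_mod_cast this
    apply Int.eq_zero_of_abs_lt_dvd hdvd
    have h1 : (m * p ^ n' : ℤ) < p ^ (n + n') := by
      rw [pow_add]; exact_mod_cast Nat.mul_lt_mul_of_pos_right h (by positivity)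
    have h2 : (m' * p ^ n : ℤ) < p ^ (n + n') := by
      rw [add_comm, pow_add]; exact_mod_cast Nat.mul_lt_mul_of_pos_right h' (by positivity)
    have h3 : (0 : ℤ) ≤ m * p ^ n' := by positivity
    have h4 : (0 : ℤ) ≤ m' * p ^ n := by positivity
    push_cast
    rw [abs_lt]; constructor <;> linarith
  rw [← sub_eq_zero, e, hz]; simp

lemma kz_aux (p : ℕ) [hp : Fact p.Prime] (c k : Matrix (Fin 2) (Fin 2) ℚ_[p]) (u : ℚ_[p])
    (hc : c 1 0 = 0) (hk : ∀ i j, ‖k i j‖ ≤ 1) (hd : ‖k.det‖ = 1) (hu : u ≠ 0)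
    (h : c = u • k) : c 0 0 ≠ 0 ∧ ‖c 0 0‖ = ‖c 1 1‖ ∧ ‖c 0 1‖ ≤ ‖c 1 1‖ := by
  subst h
  have hk0 : k 1 0 = 0 := by simpa [hu] using hc
  rw [Matrix.det_fin_two, hk0, mul_zero, sub_zero, norm_mul] at hd
  have a0 := hk 0 0
  have a1 := hk 1 1
  have n0 := norm_nonneg (k 0 0)
  have n1 := norm_nonneg (k 1 1)
  have e0 : ‖k 0 0‖ = 1 := by nlinarith
  have e1 : ‖k 1 1‖ = 1 := by nlinarith
  refine ⟨?_, ?_, ?_⟩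
  · have : k 0 0 ≠ 0 := by intro h0; simp [h0] at e0
    simp [hu, this]
  · simp [e0, e1]
  · simp only [Matrix.smul_apply, smul_eq_mul, norm_mul, e1]
    exact mul_le_mul_of_nonneg_left (hk 0 1) (norm_nonneg u)

/-- Iwasawa-type decomposition of the Borel: every upper triangular `b ∈ GL₂(ℚ_p)` admits
a unique factorization `b = [[1, β],[0, p^δ]] · c` with `β ∈ A`, `δ ∈ ℤ` and
`c ∈ B ∩ KZ`, where `A = { m/p^n : n ≥ 0, 0 ≤ m < p^n }` is a set of representatives of
`ℚ_p/ℤ_p`, `B` is the subgroup of upper triangular matrices, `K = GL₂(ℤ_p)` (integral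
entries and determinant a `p`-adic unit) and `Z` is the center (scalar matrices). -/
theorem stmt_12 (p : ℕ) [hp : Fact p.Prime]
    (A : Set ℚ_[p])
    (hA : A = {x : ℚ_[p] | ∃ n m : ℕ, m < p ^ n ∧ x = (m : ℚ_[p]) / (p : ℚ_[p]) ^ n})
    (b : GL (Fin 2) ℚ_[p])
    (hb : (b : Matrix (Fin 2) (Fin 2) ℚ_[p]) 1 0 = 0) :
    ∃! x : ℚ_[p] × ℤ × GL (Fin 2) ℚ_[p],
      x.1 ∈ A ∧
      ((x.2.2 : Matrix (Fin 2) (Fin 2) ℚ_[p]) 1 0 = 0) ∧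
      (∃ (k : Matrix (Fin 2) (Fin 2) ℚ_[p]) (u : ℚ_[p]),
        (∀ i j, ‖k i j‖ ≤ 1) ∧ ‖k.det‖ = 1 ∧ u ≠ 0 ∧
          (x.2.2 : Matrix (Fin 2) (Fin 2) ℚ_[p]) = u • k) ∧
      (b : Matrix (Fin 2) (Fin 2) ℚ_[p]) =
        !![1, x.1; 0, (p : ℚ_[p]) ^ x.2.1] * (x.2.2 : Matrix (Fin 2) (Fin 2) ℚ_[p]) := by
  have hp0 : (p : ℚ_[p]) ≠ 0 := by exact_mod_cast hp.out.ne_zero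
  have hp1 : (1 : ℝ) < p := by exact_mod_cast hp.out.one_lt
  have hdet : (b : Matrix (Fin 2) (Fin 2) ℚ_[p]).det ≠ 0 :=
    ((Matrix.isUnit_iff_isUnit_det _).1 b.isUnit).ne_zero
  rw [Matrix.det_fin_two, hb, mul_zero, sub_zero] at hdet
  generalize hB : (b : Matrix (Fin 2) (Fin 2) ℚ_[p]) = M at *
  obtain ⟨ha, hd⟩ := mul_ne_zero_iff.1 hdet
  obtain ⟨δ, hδ⟩ : ∃ δ : ℤ, ‖M 0 0‖ = ‖M 1 1 * (p : ℚ_[p]) ^ (-δ)‖ := by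
    refine ⟨(M 1 1).valuation - (M 0 0).valuation, ?_⟩
    rw [norm_mul, Padic.norm_eq_zpow_neg_valuation ha, Padic.norm_eq_zpow_neg_valuation hd,
      Padic.norm_p_zpow, ← zpow_add₀ (by positivity)]
    congr 1; ring
  have hd' : M 1 1 * (p : ℚ_[p]) ^ (-δ) ≠ 0 := mul_ne_zero hd (zpow_ne_zero _ hp0)
  have hdd : (p : ℚ_[p]) ^ δ * (M 1 1 * (p : ℚ_[p]) ^ (-δ)) = M 1 1 := by
    rw [_root_.zpow_neg]; field_simp
  generalize M 1 1 * (p : ℚ_[p]) ^ (-δ) = d' at hδ hd' hdd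
  obtain ⟨n, m, hm, hβ⟩ := exists_repr_aux p (M 0 1 / d')
  set β : ℚ_[p] := (m : ℚ_[p]) / (p : ℚ_[p]) ^ n with hβdef
  have hcdet : (!![M 0 0, M 0 1 - β * d'; 0, d'] : Matrix (Fin 2) (Fin 2) ℚ_[p]).det ≠ 0 := by
    simp [Matrix.det_fin_two, ha, hd']
  have hle : ‖M 0 1 - β * d'‖ ≤ ‖M 0 0‖ := by
    have : M 0 1 - β * d' = (M 0 1 / d' - β) * d' := by field_simp
    rw [this, norm_mul, hδ]
    exact mul_le_of_le_one_left (norm_nonneg _) hβ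
  refine ⟨(β, δ, Matrix.GeneralLinearGroup.mkOfDetNeZero _ hcdet), ⟨?_, ?_, ?_, ?_⟩, ?_⟩
  · rw [hA]; exact ⟨n, m, hm, rfl⟩
  · simp [Matrix.GeneralLinearGroup.mkOfDetNeZero]
  · have hna : 0 < ‖M 0 0‖ := norm_pos_iff.2 ha
    refine ⟨!![1, (M 0 1 - β * d') / M 0 0; 0, d' / M 0 0], M 0 0, ?_, ?_, ha, ?_⟩
    · intro i j
      fin_cases i <;> fin_cases j
      · simp
      · simpa [norm_div] using (div_le_one hna).2 hle
      · simp
      · simp [norm_div, ← hδ, hna.ne']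
    · simp [Matrix.det_fin_two, ← hδ, hna.ne']
    · ext i j
      fin_cases i <;> fin_cases j <;>
        simp [Matrix.GeneralLinearGroup.mkOfDetNeZero, mul_div_cancel₀, ha]
  · ext i j
    fin_cases i <;> fin_cases j <;>
      simp [Matrix.GeneralLinearGroup.mkOfDetNeZero, Matrix.mul_apply, Fin.sum_univ_two, hb, hdd]
  · rintro ⟨β', δ', c⟩ ⟨h1, h2, ⟨k, u, hk, hkd, hu, hc⟩, h4⟩
    dsimp only at h1 h2 hc h4
    obtain ⟨-, hc1, hc2⟩ := kz_aux p _ k u h2 hk hkd hu hc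
    have e00 : M 0 0 = c.1 0 0 := by rw [h4]; simp [Matrix.mul_apply, Fin.sum_univ_two, h2]
    have e01 : M 0 1 = c.1 0 1 + β' * c.1 1 1 := by
      rw [h4]; simp [Matrix.mul_apply, Fin.sum_univ_two]
    have e11 : M 1 1 = (p : ℚ_[p]) ^ δ' * c.1 1 1 := by
      rw [h4]; simp [Matrix.mul_apply, Fin.sum_univ_two]
    have hcne : c.1 1 1 ≠ 0 := by
      intro h0; rw [h0, mul_zero] at e11; exact hd e11
    have hδ' : δ' = δ := by
      have hn : ‖c.1 1 1‖ = ‖d'‖ := by rw [← hδ, e00, hc1]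
      have hh : ‖(p : ℚ_[p]) ^ δ * d'‖ = ‖(p : ℚ_[p]) ^ δ' * c.1 1 1‖ := by rw [hdd, e11]
      rw [norm_mul, norm_mul, hn] at hh
      have := mul_right_cancel₀ (norm_ne_zero_iff.2 hd') hh
      rw [Padic.norm_p_zpow, Padic.norm_p_zpow] at this
      have := zpow_right_injective₀ (by positivity) hp1.ne' this
      omega
    subst hδ'
    have hcd : c.1 1 1 = d' := by
      apply mul_left_cancel₀ (zpow_ne_zero δ' hp0)
      rw [← e11, hdd]
    have hββ : β' = β := by
      rw [hA] at h1
      obtain ⟨n', m', hm', rfl⟩ := h1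
      refine unique_repr_aux p _ _ _ _ hm' hm ?_
      have hx : ‖M 0 1 / d' - (m' : ℚ_[p]) / (p : ℚ_[p]) ^ n'‖ ≤ 1 := by
        have : M 0 1 / d' - (m' : ℚ_[p]) / (p : ℚ_[p]) ^ n' = c.1 0 1 / c.1 1 1 := by
          rw [← hcd, e01]; field_simp; ring
        rw [this, norm_div]
        exact (div_le_one (norm_pos_iff.2 hcne)).2 hc2
      have := Padic.nonarchimedean (M 0 1 / d' - β)
        (-(M 0 1 / d' - (m' : ℚ_[p]) / (p : ℚ_[p]) ^ n'))
      rw [norm_neg, ← sub_eq_add_neg, sub_sub_sub_cancel_left] at this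
      exact this.trans (max_le hβ hx)
    subst hββ
    have : c = Matrix.GeneralLinearGroup.mkOfDetNeZero _ hcdet := by
      apply Units.ext
      ext i j
      fin_cases i <;> fin_cases j
      · simp [Matrix.GeneralLinearGroup.mkOfDetNeZero, e00]
      · simp [Matrix.GeneralLinearGroup.mkOfDetNeZero, e01, hcd]
      · simpa [Matrix.GeneralLinearGroup.mkOfDetNeZero] using h2
      · simpa [Matrix.GeneralLinearGroup.mkOfDetNeZero] using hcd
    rw [this]
end
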